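/- For ρ > 0 small enough (depending only on v₂ and v₃), the cell energy Ẽ_cell is smooth in a neighborhood of its two minimizers (b̄, b̄, π + ψ̄) and (b̄, b̄, π − ψ̄), and there exists c_conv = c_conv(ρ) > 0 such that the Hessian satisfies D²Ẽ_cell(b̄, b̄, π ± ψ̄) ≥ c_conv · I in the sense of quadratic forms on ℝ³, where I denotes the 3×3 identity matrix. -/

import Mathlib

open Real

attribute [local instance] Classical.propDecidable

noncomputable section

/-- Counterclockwise angle from `a` to `b`, in `[0, 2π)`. -/
def ccwAngle (a b : ℂ) : ℝ :=
  if Complex.arg (b * (starRingEnd ℂ) a) < 0 then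
    Complex.arg (b * (starRingEnd ℂ) a) + 2 * π
  else Complex.arg (b * (starRingEnd ℂ) a)

/-- Bond length `b_i`. -/
def bnd (y : ℕ → ℂ) (i : ℕ) : ℝ := ‖y (i + 1) - y i‖

/-- Bond angle `φ_i = ∡(y_{i-1} − y_i, y_{i+1} − y_i)`. -/
def ang (y : ℕ → ℂ) (i : ℕ) : ℝ := ccwAngle (y (i - 1) - y i) (y (i + 1) - y i)

/-- Admissible configurations `𝒜_n` (atoms indexed `1,…,n`). -/
def Admissible (n : ℕ) (y : ℕ → ℂ) : Prop :=
  (∀ i j : ℕ, 1 ≤ i → i ≤ n → 1 ≤ j → j ≤ n → (i + 2 ≤ j ∨ j + 2 ≤ i) →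
      (1.5 : ℝ) < ‖y i - y j‖) ∧
  (∀ i : ℕ, 1 ≤ i → i + 1 ≤ n → ‖y (i + 1) - y i‖ ≤ (1.5 : ℝ))

/-- Assumptions on the two-body potential `v₂` and the three-body potential `v₃`. -/
structure PotentialPair (v₂ v₃ : ℝ → ℝ) : Prop where
  v₂_smooth : ContDiffOn ℝ (⊤ : ℕ∞) v₂ (Set.Ioi 0)
  v₂_lb : ∀ x ∈ Set.Ioi (0 : ℝ), (-1 : ℝ) ≤ v₂ x
  v₂_min : v₂ 1 = -1
  v₂_min_unique : ∀ x ∈ Set.Ioi (0 : ℝ), x ≠ 1 → v₂ 1 < v₂ x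
  v₂_conv : 0 < iteratedDeriv 2 v₂ 1
  v₂_mono : StrictMonoOn v₂ (Set.Ici 1)
  v₃_smooth : ContDiffOn ℝ (⊤ : ℕ∞) v₃ (Set.Icc 0 (2 * π))
  v₃_nonneg : ∀ x ∈ Set.Icc (0 : ℝ) (2 * π), 0 ≤ v₃ x
  v₃_symm : ∀ φ : ℝ, v₃ (π - φ) = v₃ (π + φ)
  v₃_min : v₃ π = 0
  v₃_min_unique : ∀ x ∈ Set.Icc (0 : ℝ) (2 * π), x ≠ π → 0 < v₃ x
  v₃_d1 : deriv v₃ π = 0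
  v₃_d2 : iteratedDeriv 2 v₃ π = 0
  v₃_d3 : iteratedDeriv 3 v₃ π = 0
  v₃_d4 : 0 < iteratedDeriv 4 v₃ π

/-- The cell energy in terms of bond lengths and angle. -/
def EcellT (v₂ v₃ : ℝ → ℝ) (ρ b₁ b₂ φ : ℝ) : ℝ :=
  v₂ b₁ + v₂ b₂ + ρ * v₂ (Real.sqrt (b₁ ^ 2 + b₂ ^ 2 - 2 * b₁ * b₂ * Real.cos φ)) + v₃ φ

/-- The cell energy. -/
def Ecell (v₂ v₃ : ℝ → ℝ) (ρ : ℝ) (p q r : ℂ) : ℝ :=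
  v₂ ‖q - p‖ + v₂ ‖r - q‖ + v₃ (ccwAngle (r - q) (p - q)) + ρ * v₂ ‖r - p‖

/-- The reduced energy `E^red_n`. -/
def Ered (v₂ v₃ : ℝ → ℝ) (ρ : ℝ) (n : ℕ) (y : ℕ → ℂ) : ℝ :=
  ∑ i ∈ Finset.Icc 2 (n - 1), Ecell v₂ v₃ ρ (y (i - 1)) (y i) (y (i + 1))

/-- `(b0, b0, π ± ψ)` are the only minimizers of the cell energy. -/
def IsCellMinimizer (v₂ v₃ : ℝ → ℝ) (ρ b0 ψ : ℝ) : Prop :=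
  0 < b0 ∧ b0 < 1 ∧ 0 < ψ ∧ ψ < π / 8 ∧
  (∀ b₁ ∈ Set.Ioi (0 : ℝ), ∀ b₂ ∈ Set.Ioi (0 : ℝ), ∀ φ ∈ Set.Icc (0 : ℝ) (2 * π),
      EcellT v₂ v₃ ρ b0 b0 (π + ψ) ≤ EcellT v₂ v₃ ρ b₁ b₂ φ) ∧
  (∀ b₁ ∈ Set.Ioi (0 : ℝ), ∀ b₂ ∈ Set.Ioi (0 : ℝ), ∀ φ ∈ Set.Icc (0 : ℝ) (2 * π),
      EcellT v₂ v₃ ρ b₁ b₂ φ = EcellT v₂ v₃ ρ b0 b0 (π + ψ) →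
        b₁ = b0 ∧ b₂ = b0 ∧ (φ = π + ψ ∨ φ = π - ψ))

/-- The minimal cell energy `e_cell`. -/
def eCell (v₂ v₃ : ℝ → ℝ) (ρ b0 ψ : ℝ) : ℝ := EcellT v₂ v₃ ρ b0 b0 (π + ψ)

/-- `y` is a minimizer of `E^red_n` over `𝒜_n`. -/
def MinimizesEred (v₂ v₃ : ℝ → ℝ) (ρ : ℝ) (n : ℕ) (y : ℕ → ℂ) : Prop :=
  Admissible n y ∧ ∀ y' : ℕ → ℂ, Admissible n y' → Ered v₂ v₃ ρ n y ≤ Ered v₂ v₃ ρ n y'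

/-- Single-period configurations `𝒰^l`, with transition index `i₀`. -/
def memU (b0 ψ : ℝ) (l i₀ : ℕ) (y : ℕ → ℂ) : Prop :=
  2 ≤ i₀ ∧ i₀ + 1 ≤ l ∧
  (∀ i : ℕ, 1 ≤ i → i ≤ l → bnd y i = b0) ∧
  (∀ i : ℕ, 2 ≤ i → i ≤ i₀ → ang y i = π - ψ) ∧
  (∀ i : ℕ, i₀ + 1 ≤ i → i ≤ l → ang y i = π + ψ)

/-- `⌈2π/ψ̄⌉`. -/
def nceil (ψ : ℝ) : ℕ := ⌈2 * π / ψ⌉₊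

/-- The maximal atomic period `l_max = 2⌈2π/ψ̄⌉ − 4`. -/
def lmaxN (ψ : ℝ) : ℕ := 2 * nceil ψ - 4

/-- `l_mid = ⌊6/ψ̄⌋`. -/
def lmidN (ψ : ℝ) : ℕ := ⌊(6 : ℝ) / ψ⌋₊

/-- The end-to-end length `λ^l(i₀)` of a single-period configuration. -/
def lambdaFn (b0 ψ : ℝ) (l i₀ : ℕ) : ℝ :=
  ‖∑ k ∈ Finset.Icc 1 l, (b0 : ℂ) * Complex.exp (Complex.I *
      (((if k ≤ i₀ then -(((k : ℝ) - 1) * ψ) else ((k : ℝ) - 2 * (i₀ : ℝ) + 1) * ψ) : ℝ) : ℂ))‖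

/-- The domain of the function `λ^l`. -/
def lambdaDom (ψ : ℝ) (l : ℕ) : Finset ℕ :=
  (Finset.Icc 2 (l - 1)).filter fun i₀ => l + 3 ≤ i₀ + nceil ψ ∧ i₀ + 2 ≤ nceil ψ

/-- `λ^l_max`, the maximum of `λ^l` over its domain. -/
def lambdaMax (b0 ψ : ℝ) (l : ℕ) : ℝ :=
  sSup (lambdaFn b0 ψ l '' ↑(lambdaDom ψ l))

/-- `f` is affine on `s`. -/
def AffOn (f : ℝ → ℝ) (s : Set ℝ) : Prop := ∃ a b : ℝ, ∀ x ∈ s, f x = a * x + b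

/-- `Lam` is the normalized wavelength `Λ`. -/
def IsNormWavelength (b0 ψ : ℝ) (Lam : ℝ → ℝ) : Prop :=
  (∀ l : ℕ, 2 ≤ l → l ≤ lmidN ψ → Even l → Lam (l : ℝ) = lambdaMax b0 ψ l / (l : ℝ)) ∧
  (∀ l : ℕ, 4 ≤ l → l ≤ lmidN ψ → Even l → AffOn Lam (Set.Icc ((l : ℝ) - 2) (l : ℝ))) ∧
  AffOn Lam (Set.Icc ((lmidN ψ : ℝ) - 2) (lmaxN ψ : ℝ))

/-- `y ∈ 𝒰^l_δ`, with associated configuration `ybar ∈ 𝒰^l`. -/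
def AssocPerturb (b0 ψ δ : ℝ) (l : ℕ) (y ybar : ℕ → ℂ) : Prop :=
  Admissible (l + 1) y ∧ (∃ i₀ : ℕ, memU b0 ψ l i₀ ybar) ∧
  (∀ i : ℕ, 1 ≤ i → i ≤ l → |bnd y i - b0| ≤ δ) ∧
  (∀ i : ℕ, 2 ≤ i → i ≤ l → |ang y i - ang ybar i| ≤ δ)

/-- `𝒜^δ_n`. -/
def AdmissiblePerturbed (b0 ψ δ : ℝ) (n : ℕ) (y : ℕ → ℂ) : Prop :=
  Admissible n y ∧ (∀ i : ℕ, 1 ≤ i → i + 1 ≤ n → |bnd y i - b0| ≤ δ) ∧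
  (∀ i : ℕ, 2 ≤ i → i + 1 ≤ n → min |ang y i - (π + ψ)| |ang y i - (π - ψ)| ≤ δ)

/-- The property of the constant `c_mix` in the length estimate for odd atomic periods. -/
def MixConst (b0 ψ c : ℝ) : Prop :=
  ∀ l₁ l₂ : ℕ, Odd l₁ → Odd l₂ → 2 ≤ l₁ → l₁ ≤ lmaxN ψ → 2 ≤ l₂ → l₂ ≤ lmaxN ψ →
    ∀ y : ℕ → ℂ,
      (∃ i₀ : ℕ, memU b0 ψ (l₁ + 1) i₀ y) →
      (∃ i₀ : ℕ, memU b0 ψ (l₂ - 1) i₀ (fun i => y (i + l₁ + 1))) →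
      (∃ m : ℤ, ang y (l₁ + 2) - π = (2 * (m : ℝ) + 1) * ψ) →
      ‖y (l₁ + l₂ + 1) - y 1‖ ≤
        max (lambdaMax b0 ψ (l₁ + 1) + lambdaMax b0 ψ (l₂ - 1))
            (lambdaMax b0 ψ (l₁ - 1) + lambdaMax b0 ψ (l₂ + 1))
          - (if l₂ ≤ l₁ then c else 0)

/-- `𝓘_sgn`. -/
def Isgn (n : ℕ) (y : ℕ → ℂ) : Finset ℕ :=
  ((Finset.Icc 3 (n - 2)).filter fun i => π < ang y i ∧ ang y (i + 1) < π) ∪ {1}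

/-- `𝓘^l_sgn`. -/
def IsgnL (n : ℕ) (y : ℕ → ℂ) (l : ℕ) : Finset ℕ :=
  (Isgn n y).filter fun i =>
    (∀ k : ℕ, 1 ≤ k → k ≤ l - 1 → i + k ∉ Isgn n y) ∧ (i + l ∈ Isgn n y ∨ i + l = n)

/-- The maximal length of odd atomic periods `ℒ`. -/
def maxOddLength (ψ : ℝ) (Lam : ℝ → ℝ) (N S : ℕ) : ℝ :=
  sSup { x : ℝ | ∃ r : ℕ → ℕ,
    (∀ l : ℕ, r l ≠ 0 → Even l ∧ 2 ≤ l ∧ l ≤ lmaxN ψ) ∧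
    (∑ l ∈ Finset.Icc 2 (lmaxN ψ), r l) = N ∧
    (∑ l ∈ Finset.Icc 2 (lmaxN ψ), l * r l) = 2 * (S / 2) ∧
    x = ∑ l ∈ Finset.Icc 2 (lmaxN ψ), (r l : ℝ) * (l : ℝ) * Lam (l : ℝ) }

/-- The generalized cell energy. -/
def EgenCell (v₂ v₃ : ℝ → ℝ) (ρ ρ' : ℝ) (p q r s : ℂ) : ℝ :=
  (Ecell v₂ v₃ ρ p q r + Ecell v₂ v₃ ρ q r s) / 2 + ρ' * v₂ ‖s - p‖

/-- The configurational (general) energy `E_n`. -/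
def Egen (v₂ v₃ : ℝ → ℝ) (ρ ρ' : ℝ) (n : ℕ) (y : ℕ → ℂ) : ℝ :=
  Ered v₂ v₃ ρ n y + ρ' * ∑ i ∈ Finset.Icc 1 (n - 3), v₂ ‖y (i + 3) - y i‖

/-- The boundary condition `(y_n − y_1)·e₁ = (n−1)μ`. -/
def BC (n : ℕ) (μ : ℝ) (y : ℕ → ℂ) : Prop := (y n - y 1).re = ((n : ℝ) - 1) * μ

/-- The minimal energy `E^{n,μ}_min`. -/
def Emin (v₂ v₃ : ℝ → ℝ) (ρ ρ' μ : ℝ) (n : ℕ) : ℝ :=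
  sInf {E : ℝ | ∃ y : ℕ → ℂ, Admissible n y ∧ BC n μ y ∧ E = Egen v₂ v₃ ρ ρ' n y} /
    ((n : ℝ) - 2)

/-- `egen` is the common value `e^gen_cell`. -/
def IsEgenCellVal (v₂ v₃ : ℝ → ℝ) (ρ ρ' egen : ℝ) : Prop :=
  ∀ n : ℕ, ∀ y : ℕ → ℂ, MinimizesEred v₂ v₃ ρ n y →
    ∀ i : ℕ, 1 ≤ i → i + 3 ≤ n →
      Real.sign (ang y (i + 1) - π) = Real.sign (ang y (i + 2) - π) →
        EgenCell v₂ v₃ ρ ρ' (y i) (y (i + 1)) (y (i + 2)) (y (i + 3)) = egen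

/-- `eper` is the common value `e_per`. -/
def IsEperVal (v₂ v₃ : ℝ → ℝ) (ρ ρ' egen eper : ℝ) : Prop :=
  ∀ n : ℕ, ∀ y : ℕ → ℂ, MinimizesEred v₂ v₃ ρ n y →
    ∀ i : ℕ, 1 ≤ i → i + 3 ≤ n →
      Real.sign (ang y (i + 1) - π) ≠ Real.sign (ang y (i + 2) - π) →
        EgenCell v₂ v₃ ρ ρ' (y i) (y (i + 1)) (y (i + 2)) (y (i + 3)) = egen + ρ' * eper

/-- `f` is piecewise affine on `s`. -/
def PiecewiseAffOn (f : ℝ → ℝ) (s : Set ℝ) : Prop :=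
  ∃ P : Finset ℝ, ∀ a b : ℝ, a ∈ s → b ∈ s → a ≤ b → (∀ z ∈ P, z ∉ Set.Ioo a b) →
    AffOn f (Set.Icc a b ∩ s)

/-- The data `(e^gen_cell, e_range, c)` from the characterization of the minimal energy. -/
def EnergyChar (v₂ v₃ : ℝ → ℝ) (ρ ρ' m₁ m₂ egen : ℝ) (erange : ℝ → ℝ) (c : ℝ) : Prop :=
  0 < c ∧ StrictMonoOn erange (Set.Icc m₁ m₂) ∧ ConvexOn ℝ (Set.Icc m₁ m₂) erange ∧
  PiecewiseAffOn erange (Set.Icc m₁ m₂) ∧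
  ∀ μ ∈ Set.Icc m₁ m₂, ∀ n : ℕ, 3 ≤ n →
    |egen + ρ' * erange μ - Emin v₂ v₃ ρ ρ' μ n| ≤ c * (ρ' ^ 2 + 1 / (n : ℝ))

/-- The set of resonant lengths `M_res`. -/
def Mres (m₁ m₂ : ℝ) (erange : ℝ → ℝ) : Set ℝ :=
  {μ | μ ∈ Set.Icc m₁ m₂ ∧ ¬ DifferentiableWithinAt ℝ erange (Set.Icc m₁ m₂) μ}

/-- `𝒞(y)`, the set of atoms where the chain changes its curvature. -/
def Cset (n : ℕ) (y : ℕ → ℂ) : Finset ℕ :=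
  (Finset.Icc 2 (n - 2)).filter fun i => π < ang y i ∧ ang y (i + 1) < π

/-- `j` is the successor of `i` in `C`. -/
def SuccIn (C : Finset ℕ) (i j : ℕ) : Prop :=
  i ∈ C ∧ j ∈ C ∧ i < j ∧ ∀ k ∈ C, i < k → j ≤ k

/-- Almost minimizers of `E^{n,μ}_min`. -/
def AlmostMin (v₂ v₃ : ℝ → ℝ) (ρ ρ' μ c : ℝ) (n : ℕ) (y : ℕ → ℂ) : Prop :=
  Admissible n y ∧ BC n μ y ∧
    Egen v₂ v₃ ρ ρ' n y / ((n : ℝ) - 2) ≤ Emin v₂ v₃ ρ ρ' μ n + c * (ρ' ^ 2 + 1 / (n : ℝ))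

lemma hess_curve {E : Type*} [NormedAddCommGroup E] [NormedSpace ℝ E] {f : E → ℝ} {x v : E} (hf : ContDiffAt ℝ 2 f x) :
    iteratedFDeriv ℝ 2 f x ![v, v] = deriv (deriv (fun t : ℝ => f (x + t • v))) 0 := by
  rw [iteratedFDeriv_two_apply]
  simp only [Matrix.cons_val_zero, Matrix.cons_val_one]
  have hev : ∀ᶠ y in nhds x, DifferentiableAt ℝ f y := by
    have h := hf.eventually (by simp)
    filter_upwards [h] with y hy
    exact hy.differentiableAt (by simp)
  have hl : ∀ t : ℝ, HasDerivAt (fun t : ℝ => x + t • v) v t := by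
    intro t
    simpa using ((hasDerivAt_id t).smul_const v).const_add x
  have hc : Filter.Tendsto (fun t : ℝ => x + t • v) (nhds 0) (nhds x) := by
    have := (hl 0).continuousAt.tendsto
    simpa using this
  have he : deriv (fun t : ℝ => f (x + t • v)) =ᶠ[nhds 0] fun t => fderiv ℝ f (x + t • v) v := by
    filter_upwards [hc.eventually hev] with t ht
    exact (ht.hasFDerivAt.comp_hasDerivAt t (hl t)).deriv
  rw [he.deriv_eq]
  have hd : DifferentiableAt ℝ (fderiv ℝ f) (x + (0 : ℝ) • v) := by
    simp only [zero_smul, add_zero]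
    exact (hf.fderiv_right (m := 1) (by norm_num)).differentiableAt (by simp)
  have h2 : HasDerivAt (fun t : ℝ => fderiv ℝ f (x + t • v))
      (fderiv ℝ (fderiv ℝ f) (x + (0 : ℝ) • v) v) 0 :=
    hd.hasFDerivAt.comp_hasDerivAt (0 : ℝ) (hl 0)
  have h3 : HasDerivAt (fun t : ℝ => fderiv ℝ f (x + t • v) v)
      (fderiv ℝ (fderiv ℝ f) (x + (0 : ℝ) • v) v v) 0 :=
    ((ContinuousLinearMap.apply ℝ ℝ v).hasFDerivAt.comp_hasDerivAt (0 : ℝ) h2)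
  rw [h3.deriv, zero_smul, add_zero]

lemma deriv_smooth {f : ℝ → ℝ} {s : Set ℝ} (hs : IsOpen s) (hf : ContDiffOn ℝ (⊤ : ℕ∞) f s) :
    ContDiffOn ℝ (⊤ : ℕ∞) (deriv f) s :=
  hf.deriv_of_isOpen hs (by simp)

lemma hasDeriv_smooth {f : ℝ → ℝ} {s : Set ℝ} (hs : IsOpen s) (hf : ContDiffOn ℝ (⊤ : ℕ∞) f s)
    {x : ℝ} (hx : x ∈ s) : HasDerivAt f (deriv f x) x :=
  ((hf.contDiffAt (hs.mem_nhds hx)).differentiableAt (by simp)).hasDerivAt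

/-- squared third distance along a line -/
def qf (b φ v0 v1 v2 t : ℝ) : ℝ :=
  (b + t * v0) ^ 2 + (b + t * v1) ^ 2 - 2 * (b + t * v0) * (b + t * v1) * Real.cos (φ + t * v2)

def qf1 (b φ v0 v1 v2 t : ℝ) : ℝ :=
  2 * (b + t * v0) * v0 + 2 * (b + t * v1) * v1
    - 2 * (v0 * (b + t * v1) + (b + t * v0) * v1) * Real.cos (φ + t * v2)
    + 2 * (b + t * v0) * (b + t * v1) * Real.sin (φ + t * v2) * v2

def qf2 (b φ v0 v1 v2 t : ℝ) : ℝ :=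
  2 * v0 ^ 2 + 2 * v1 ^ 2 - 4 * v0 * v1 * Real.cos (φ + t * v2)
    + 4 * (v0 * (b + t * v1) + (b + t * v0) * v1) * Real.sin (φ + t * v2) * v2
    + 2 * (b + t * v0) * (b + t * v1) * Real.cos (φ + t * v2) * v2 ^ 2

lemma lin_deriv (b v t : ℝ) : HasDerivAt (fun t : ℝ => b + t * v) v t := by
  simpa using ((hasDerivAt_id t).mul_const v).const_add b

lemma qf_deriv (b φ v0 v1 v2 t : ℝ) :
    HasDerivAt (qf b φ v0 v1 v2) (qf1 b φ v0 v1 v2 t) t := by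
  have h0 := lin_deriv b v0 t
  have h1 := lin_deriv b v1 t
  have h2 := (lin_deriv φ v2 t).cos
  have h := ((h0.pow 2).add (h1.pow 2)).sub (((h0.const_mul 2).mul h1).mul h2)
  refine h.congr_deriv ?_
  simp only [qf1, Pi.mul_apply]
  push_cast
  ring

lemma qf1_deriv (b φ v0 v1 v2 t : ℝ) :
    HasDerivAt (qf1 b φ v0 v1 v2) (qf2 b φ v0 v1 v2 t) t := by
  have h0 := lin_deriv b v0 t
  have h1 := lin_deriv b v1 t
  have h2 := (lin_deriv φ v2 t).cos
  have h3 := (lin_deriv φ v2 t).sin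
  have h := ((((h0.const_mul 2).mul_const v0).add ((h1.const_mul 2).mul_const v1)).sub
    ((((h1.const_mul v0).add (h0.mul_const v1)).const_mul 2).mul h2)).add
    ((((h0.const_mul 2).mul h1).mul h3).mul_const v2)
  refine h.congr_deriv ?_
  simp only [qf2, Pi.mul_apply, Pi.add_apply]
  ring

/-- first derivative of the energy along a line -/
def Df (v₂ v₃ : ℝ → ℝ) (ρ b φ v0 v1 v2 t : ℝ) : ℝ :=
  deriv v₂ (b + t * v0) * v0 + deriv v₂ (b + t * v1) * v1
    + ρ * (deriv v₂ (√(qf b φ v0 v1 v2 t)) * (qf1 b φ v0 v1 v2 t / (2 * √(qf b φ v0 v1 v2 t))))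
    + deriv v₃ (φ + t * v2) * v2

lemma curve_deriv1 {v₂ v₃ : ℝ → ℝ} (hpot : PotentialPair v₂ v₃) (ρ b φ v0 v1 v2 t : ℝ)
    (h0 : 0 < b + t * v0) (h1 : 0 < b + t * v1) (hq : 0 < qf b φ v0 v1 v2 t)
    (h2 : φ + t * v2 ∈ Set.Ioo 0 (2 * π)) :
    HasDerivAt (fun t => EcellT v₂ v₃ ρ (b + t * v0) (b + t * v1) (φ + t * v2))
      (Df v₂ v₃ ρ b φ v0 v1 v2 t) t := by
  have s3 := hpot.v₃_smooth.mono Set.Ioo_subset_Icc_self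
  have e0 := (hasDeriv_smooth isOpen_Ioi hpot.v₂_smooth h0).comp t (lin_deriv b v0 t)
  have e1 := (hasDeriv_smooth isOpen_Ioi hpot.v₂_smooth h1).comp t (lin_deriv b v1 t)
  have e2 := (hasDeriv_smooth isOpen_Ioo s3 h2).comp t (lin_deriv φ v2 t)
  have e3 := (hasDeriv_smooth isOpen_Ioi hpot.v₂_smooth (Real.sqrt_pos.2 hq)).comp t
    ((qf_deriv b φ v0 v1 v2 t).sqrt hq.ne')
  exact ((e0.add e1).add (e3.const_mul ρ)).add e2

lemma curve_deriv2 {v₂ v₃ : ℝ → ℝ} (hpot : PotentialPair v₂ v₃) (ρ b φ v0 v1 v2 t : ℝ)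
    (h0 : 0 < b + t * v0) (h1 : 0 < b + t * v1) (hq : 0 < qf b φ v0 v1 v2 t)
    (h2 : φ + t * v2 ∈ Set.Ioo 0 (2 * π)) :
    HasDerivAt (Df v₂ v₃ ρ b φ v0 v1 v2)
      (deriv (deriv v₂) (b + t * v0) * v0 ^ 2 + deriv (deriv v₂) (b + t * v1) * v1 ^ 2
      + ρ * (deriv (deriv v₂) (√(qf b φ v0 v1 v2 t)) *
            (qf1 b φ v0 v1 v2 t / (2 * √(qf b φ v0 v1 v2 t))) ^ 2
          + deriv v₂ (√(qf b φ v0 v1 v2 t)) *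
            (qf2 b φ v0 v1 v2 t / (2 * √(qf b φ v0 v1 v2 t))
              - (qf1 b φ v0 v1 v2 t / (2 * √(qf b φ v0 v1 v2 t))) ^ 2 / √(qf b φ v0 v1 v2 t)))
      + deriv (deriv v₃) (φ + t * v2) * v2 ^ 2) t := by
  have s2 := deriv_smooth isOpen_Ioi hpot.v₂_smooth
  have s3 := deriv_smooth isOpen_Ioo (hpot.v₃_smooth.mono Set.Ioo_subset_Icc_self)
  have e0 := ((hasDeriv_smooth isOpen_Ioi s2 h0).comp t (lin_deriv b v0 t)).mul_const v0
  have e1 := ((hasDeriv_smooth isOpen_Ioi s2 h1).comp t (lin_deriv b v1 t)).mul_const v1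
  have e2 := ((hasDeriv_smooth isOpen_Ioo s3 h2).comp t (lin_deriv φ v2 t)).mul_const v2
  have hL := Real.sqrt_pos.2 hq
  have eL := (qf_deriv b φ v0 v1 v2 t).sqrt hq.ne'
  have e3 := (hasDeriv_smooth isOpen_Ioi s2 hL).comp t eL
  have e4 := (qf1_deriv b φ v0 v1 v2 t).div (eL.const_mul 2) (by positivity)
  refine (((e0.add e1).add ((e3.mul e4).const_mul ρ)).add e2).congr_deriv ?_
  simp only [Function.comp_apply, Pi.div_apply]
  field_simp

lemma curve_second {v₂ v₃ : ℝ → ℝ} (hpot : PotentialPair v₂ v₃) (ρ b φ v0 v1 v2 : ℝ)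
    (hb : 0 < b) (hq : 0 < qf b φ v0 v1 v2 0) (h2 : φ ∈ Set.Ioo 0 (2 * π)) :
    deriv (deriv (fun t => EcellT v₂ v₃ ρ (b + t * v0) (b + t * v1) (φ + t * v2))) 0 =
      deriv (deriv v₂) b * v0 ^ 2 + deriv (deriv v₂) b * v1 ^ 2
      + ρ * (deriv (deriv v₂) (√(qf b φ v0 v1 v2 0)) *
            (qf1 b φ v0 v1 v2 0 / (2 * √(qf b φ v0 v1 v2 0))) ^ 2
          + deriv v₂ (√(qf b φ v0 v1 v2 0)) *
            (qf2 b φ v0 v1 v2 0 / (2 * √(qf b φ v0 v1 v2 0))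
              - (qf1 b φ v0 v1 v2 0 / (2 * √(qf b φ v0 v1 v2 0))) ^ 2 / √(qf b φ v0 v1 v2 0)))
      + deriv (deriv v₃) φ * v2 ^ 2 := by
  have he : deriv (fun t => EcellT v₂ v₃ ρ (b + t * v0) (b + t * v1) (φ + t * v2))
      =ᶠ[nhds 0] Df v₂ v₃ ρ b φ v0 v1 v2 := by
    have c0 : ∀ᶠ t in nhds (0 : ℝ), b + t * v0 ∈ Set.Ioi (0 : ℝ) :=
      (lin_deriv b v0 0).continuousAt.eventually_mem (isOpen_Ioi.mem_nhds (by simpa using hb))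
    have c1 : ∀ᶠ t in nhds (0 : ℝ), b + t * v1 ∈ Set.Ioi (0 : ℝ) :=
      (lin_deriv b v1 0).continuousAt.eventually_mem (isOpen_Ioi.mem_nhds (by simpa using hb))
    have c2 : ∀ᶠ t in nhds (0 : ℝ), φ + t * v2 ∈ Set.Ioo 0 (2 * π) :=
      (lin_deriv φ v2 0).continuousAt.eventually_mem (isOpen_Ioo.mem_nhds (by simpa using h2))
    have c3 : ∀ᶠ t in nhds (0 : ℝ), qf b φ v0 v1 v2 t ∈ Set.Ioi (0 : ℝ) :=
      (qf_deriv b φ v0 v1 v2 0).continuousAt.eventually_mem (isOpen_Ioi.mem_nhds hq)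
    filter_upwards [c0, c1, c2, c3] with t a0 a1 a2 a3
    exact (curve_deriv1 hpot ρ b φ v0 v1 v2 t a0 a1 a3 a2).deriv
  rw [he.deriv_eq, (curve_deriv2 hpot ρ b φ v0 v1 v2 0 (by simpa using hb) (by simpa using hb) hq
    (by simpa using h2)).deriv]
  simp

/-- The second derivative in half-angle form. -/
lemma curve_second_half {v₂ v₃ : ℝ → ℝ} (hpot : PotentialPair v₂ v₃) (ρ b ψ v0 v1 v2 : ℝ)
    (hb : 0 < b) (hψ : 0 < ψ) (hψ2 : ψ < π / 8) :
    deriv (deriv (fun t => EcellT v₂ v₃ ρ (b + t * v0) (b + t * v1) (π + ψ + t * v2))) 0 =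
      deriv (deriv v₂) b * (v0 ^ 2 + v1 ^ 2) + deriv (deriv v₃) (π + ψ) * v2 ^ 2
      + ρ * deriv (deriv v₂) (2 * b * cos (ψ / 2)) *
          ((v0 + v1) * cos (ψ / 2) - b * sin (ψ / 2) * v2) ^ 2
      + ρ * deriv v₂ (2 * b * cos (ψ / 2)) *
          (sin (ψ / 2) ^ 2 / (2 * b * cos (ψ / 2)) * (v0 - v1) ^ 2
            - sin (ψ / 2) * (v0 + v1) * v2 - b * cos (ψ / 2) / 2 * v2 ^ 2) := by
  have hc : 0 < cos (ψ / 2) := cos_pos_of_mem_Ioo ⟨by linarith, by linarith [pi_pos]⟩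
  have hC : cos (π + ψ) = -(2 * cos (ψ / 2) ^ 2 - 1) := by
    rw [add_comm, cos_add_pi, ← cos_two_mul]; ring_nf
  have hS : sin (π + ψ) = -(2 * sin (ψ / 2) * cos (ψ / 2)) := by
    rw [add_comm, sin_add_pi, ← sin_two_mul]; ring_nf
  have hs2 : sin (ψ / 2) ^ 2 = 1 - cos (ψ / 2) ^ 2 := by
    linarith [sin_sq_add_cos_sq (ψ / 2)]
  have hqe : qf b (π + ψ) v0 v1 v2 0 = (2 * b * cos (ψ / 2)) ^ 2 := by
    simp only [qf, zero_mul, add_zero, hC]; ring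
  have hsq : √(qf b (π + ψ) v0 v1 v2 0) = 2 * b * cos (ψ / 2) := by
    rw [hqe, Real.sqrt_sq (by positivity)]
  rw [curve_second hpot ρ b (π + ψ) v0 v1 v2 hb (by rw [hqe]; positivity)
    ⟨by linarith [pi_pos], by linarith [pi_pos]⟩, hsq]
  have hL1 : qf1 b (π + ψ) v0 v1 v2 0 / (2 * (2 * b * cos (ψ / 2))) =
      (v0 + v1) * cos (ψ / 2) - b * sin (ψ / 2) * v2 := by
    simp only [qf1, zero_mul, add_zero, hC, hS]
    field_simp
    ring
  have hL2 : qf2 b (π + ψ) v0 v1 v2 0 / (2 * (2 * b * cos (ψ / 2))) -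
      ((v0 + v1) * cos (ψ / 2) - b * sin (ψ / 2) * v2) ^ 2 / (2 * b * cos (ψ / 2)) =
      (sin (ψ / 2) ^ 2 / (2 * b * cos (ψ / 2)) * (v0 - v1) ^ 2
            - sin (ψ / 2) * (v0 + v1) * v2 - b * cos (ψ / 2) / 2 * v2 ^ 2) := by
    have hsqr : ((v0 + v1) * cos (ψ / 2) - b * sin (ψ / 2) * v2) ^ 2 =
        (v0 + v1) ^ 2 * cos (ψ / 2) ^ 2 - 2 * b * (v0 + v1) * v2 * sin (ψ / 2) * cos (ψ / 2)
          + b ^ 2 * v2 ^ 2 * (1 - cos (ψ / 2) ^ 2) := by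
      rw [← hs2]; ring
    rw [hsqr, hs2]
    simp only [qf2, zero_mul, add_zero, hC, hS]
    field_simp
    ring
  rw [hL1, hL2]
  ring

/-- Criticality in the angle. -/
lemma crit_angle {v₂ v₃ : ℝ → ℝ} (hpot : PotentialPair v₂ v₃) (ρ b ψ : ℝ)
    (h : IsCellMinimizer v₂ v₃ ρ b ψ) :
    deriv v₃ (π + ψ) = ρ * deriv v₂ (2 * b * cos (ψ / 2)) * (b * sin (ψ / 2)) := by
  obtain ⟨hb, -, hψ, hψ2, hmin, -⟩ := h
  have hc : 0 < cos (ψ / 2) := cos_pos_of_mem_Ioo ⟨by linarith, by linarith [pi_pos]⟩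
  have hC : cos (π + ψ) = -(2 * cos (ψ / 2) ^ 2 - 1) := by
    rw [add_comm, cos_add_pi, ← cos_two_mul]; ring_nf
  have hS : sin (π + ψ) = -(2 * sin (ψ / 2) * cos (ψ / 2)) := by
    rw [add_comm, sin_add_pi, ← sin_two_mul]; ring_nf
  have hqe : qf b (π + ψ) 0 0 1 0 = (2 * b * cos (ψ / 2)) ^ 2 := by
    simp only [qf, zero_mul, add_zero, hC]; ring
  have hsq : √(qf b (π + ψ) 0 0 1 0) = 2 * b * cos (ψ / 2) := by
    rw [hqe, Real.sqrt_sq (by positivity)]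
  have hm : π + ψ ∈ Set.Ioo 0 (2 * π) := ⟨by linarith [pi_pos], by linarith [pi_pos]⟩
  have hd := curve_deriv1 hpot ρ b (π + ψ) 0 0 1 0 (by simpa using hb) (by simpa using hb)
    (by rw [hqe]; positivity) (by simpa using hm)
  have hloc : IsLocalMin (fun t => EcellT v₂ v₃ ρ (b + t * 0) (b + t * 0) (π + ψ + t * 1)) 0 := by
    have c2 : ∀ᶠ t in nhds (0 : ℝ), π + ψ + t * 1 ∈ Set.Ioo 0 (2 * π) :=
      (lin_deriv (π + ψ) 1 0).continuousAt.eventually_mem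
        (isOpen_Ioo.mem_nhds (by simpa using hm))
    filter_upwards [c2] with t ht
    simpa using hmin b hb b hb _ (Set.Ioo_subset_Icc_self (by simpa using ht))
  have h0 := hloc.hasDerivAt_eq_zero hd
  simp only [Df, hsq, qf1, zero_mul, mul_zero, add_zero, hC, hS] at h0
  have hx : deriv v₃ (π + ψ) - ρ * deriv v₂ (2 * b * cos (ψ / 2)) * (b * sin (ψ / 2)) = 0 := by
    rw [← h0]
    field_simp
    ring_nf
  linarith

/-- Taylor-type comparison. -/
lemma cmp_of_deriv {F F' P P' : ℝ → ℝ} {a d : ℝ} (hF : ∀ x ∈ Set.Ico a d, HasDerivAt F (F' x) x)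
    (hP : ∀ x ∈ Set.Ico a d, HasDerivAt P (P' x) x) (h0 : F a = P a)
    (hle : ∀ x ∈ Set.Ico a d, F' x ≤ P' x) : ∀ x ∈ Set.Ico a d, F x ≤ P x := by
  have hm : MonotoneOn (fun x => P x - F x) (Set.Ico a d) := by
    refine monotoneOn_of_hasDerivWithinAt_nonneg (f' := fun x => P' x - F' x) (convex_Ico a d)
      (fun x hx => ((hP x hx).sub (hF x hx)).continuousAt.continuousWithinAt) ?_ ?_
    · intro x hx
      exact ((hP x (interior_subset hx)).sub (hF x (interior_subset hx))).hasDerivWithinAt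
    · intro x hx
      linarith [hle x (interior_subset hx)]
  intro x hx
  have := hm (Set.left_mem_Ico.2 (lt_of_le_of_lt hx.1 hx.2)) hx hx.1
  simp only at this
  linarith

lemma pow_deriv (a k : ℝ) (n : ℕ) (x : ℝ) :
    HasDerivAt (fun x => k * (x - a) ^ (n + 1)) (k * (n + 1) * (x - a) ^ n) x := by
  have := (((hasDerivAt_id x).sub_const a).pow (n + 1)).const_mul k
  refine this.congr_deriv ?_
  simp
  ring

lemma taylor_v3 {v₂ v₃ : ℝ → ℝ} (hpot : PotentialPair v₂ v₃) :
    ∃ δ κ K : ℝ, 0 < δ ∧ 0 < κ ∧ 0 < K ∧ ∀ ψ, 0 < ψ → ψ < δ →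
      0 ≤ deriv v₃ (π + ψ) ∧ deriv v₃ (π + ψ) ≤ K * ψ ^ 3 ∧
      κ * ψ ^ 3 ≤ ψ * deriv (deriv v₃) (π + ψ) - deriv v₃ (π + ψ) := by
  have s0 := hpot.v₃_smooth.mono (Set.Ioo_subset_Icc_self)
  have s1 := deriv_smooth isOpen_Ioo s0
  have s2 := deriv_smooth isOpen_Ioo s1
  have s3 := deriv_smooth isOpen_Ioo s2
  have s4 := deriv_smooth isOpen_Ioo s3
  have z1 := hpot.v₃_d1
  have z2 := hpot.v₃_d2
  have z3 := hpot.v₃_d3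
  have z4 := hpot.v₃_d4
  simp only [iteratedDeriv_succ, iteratedDeriv_zero] at z2 z3 z4
  set c := deriv (deriv (deriv (deriv v₃))) π with hc
  have hπ : π ∈ Set.Ioo 0 (2 * π) := ⟨pi_pos, by linarith [pi_pos]⟩
  have hcont : ContinuousAt (deriv (deriv (deriv (deriv v₃)))) π :=
    (s4.contDiffAt (isOpen_Ioo.mem_nhds hπ)).continuousAt
  have hev : ∀ᶠ x in nhds π, deriv (deriv (deriv (deriv v₃))) x ∈ Set.Ioo (c / 2) (2 * c) :=
    hcont.eventually_mem (isOpen_Ioo.mem_nhds ⟨by linarith, by linarith⟩)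
  obtain ⟨δ, hδ, hball⟩ := Metric.eventually_nhds_iff.1
    (hev.and (isOpen_Ioo.eventually_mem hπ))
  have hI : ∀ x ∈ Set.Ico π (π + δ), deriv (deriv (deriv (deriv v₃))) x ∈ Set.Ioo (c / 2) (2 * c) ∧
      x ∈ Set.Ioo 0 (2 * π) := by
    intro x hx
    apply hball
    rw [Real.dist_eq, abs_lt]
    constructor <;> linarith [hx.1, hx.2]
  have d1 := fun x hx => hasDeriv_smooth isOpen_Ioo s1 (hI x hx).2
  have d2 := fun x hx => hasDeriv_smooth isOpen_Ioo s2 (hI x hx).2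
  have d3 := fun x hx => hasDeriv_smooth isOpen_Ioo s3 (hI x hx).2
  have l3 := cmp_of_deriv (fun x _ => pow_deriv π (c / 2) 0 x) d3 (by simp [z3])
    (fun x hx => by have := (hI x hx).1.1; simpa using this.le)
  have u3 := cmp_of_deriv d3 (fun x _ => pow_deriv π (2 * c) 0 x) (by simp [z3])
    (fun x hx => by have := (hI x hx).1.2; simpa using this.le)
  have l2 := cmp_of_deriv (fun x _ => pow_deriv π (c / 4) 1 x) d2 (by simp [z2])
    (fun x hx => by have := l3 x hx; norm_num at this ⊢; linarith)
  have u2 := cmp_of_deriv d2 (fun x _ => pow_deriv π c 1 x) (by simp [z2])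
    (fun x hx => by have := u3 x hx; norm_num at this ⊢; linarith)
  have l1 := cmp_of_deriv (fun x _ => pow_deriv π (c / 12) 2 x) d1 (by simp [z1])
    (fun x hx => by have := l2 x hx; norm_num at this ⊢; linarith)
  have u1 := cmp_of_deriv d1 (fun x _ => pow_deriv π (c / 3) 2 x) (by simp [z1])
    (fun x hx => by have := u2 x hx; norm_num at this ⊢; linarith)
  have lh := cmp_of_deriv (F := fun x => c / 6 * (x - π) ^ 3)
    (P := fun x => (x - π) * deriv (deriv v₃) x - deriv v₃ x)
    (fun x _ => pow_deriv π (c / 6) 2 x)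
    (fun x hx => (((hasDerivAt_id x).sub_const π).mul (d2 x hx)).sub (d1 x hx)) (by simp [z1])
    (fun x hx => by
      have h := l3 x hx
      have hx1 := hx.1
      norm_num at h ⊢
      nlinarith [mul_le_mul_of_nonneg_left h (sub_nonneg.2 hx1)])
  refine ⟨δ, c / 6, c / 3, hδ, by linarith, by linarith, fun ψ h1 h2 => ?_⟩
  have hm : π + ψ ∈ Set.Ico π (π + δ) := ⟨by linarith, by linarith⟩
  have a1 := l1 _ hm
  have a2 := u1 _ hm
  have a3 := lh _ hm
  simp only [add_sub_cancel_left] at a1 a2 a3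
  refine ⟨le_trans (by positivity) a1, a2, a3⟩

lemma sqrt_half {b ψ : ℝ} (hb : 0 < b) (hψ : 0 < ψ) (hψ2 : ψ < π / 8) :
    √(b ^ 2 + b ^ 2 - 2 * b * b * cos (π + ψ)) = 2 * b * cos (ψ / 2) ∧ 0 < cos (ψ / 2) := by
  have hc : 0 < cos (ψ / 2) := cos_pos_of_mem_Ioo ⟨by linarith, by linarith [pi_pos]⟩
  have hC : cos (π + ψ) = -(2 * cos (ψ / 2) ^ 2 - 1) := by
    rw [add_comm, cos_add_pi, ← cos_two_mul]; ring_nf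
  refine ⟨?_, hc⟩
  rw [hC, show b ^ 2 + b ^ 2 - 2 * b * b * -(2 * cos (ψ / 2) ^ 2 - 1)
    = (2 * b * cos (ψ / 2)) ^ 2 by ring, Real.sqrt_sq (by positivity)]

/-- For small `ρ` the minimizer is close to `(1, 1, π)`. -/
lemma minimizer_close {v₂ v₃ : ℝ → ℝ} (hpot : PotentialPair v₂ v₃) (η : ℝ) (hη : 0 < η) :
    ∃ ρ₀ : ℝ, 0 < ρ₀ ∧ ∀ ρ, 0 < ρ → ρ ≤ ρ₀ → ∀ b ψ, IsCellMinimizer v₂ v₃ ρ b ψ →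
      1 - η < b ∧ ψ < η := by
  by_cases H : ∃ m > 0, ∃ r > 0, ∀ x, 0 < x → x < r → -1 + m ≤ v₂ x
  · obtain ⟨m, hm, r, hr, hmr⟩ := H
    have hc2 : ContinuousOn v₂ (Set.Icc r (1 - η)) :=
      hpot.v₂_smooth.continuousOn.mono fun x hx => lt_of_lt_of_le hr hx.1
    obtain ⟨a2, ha2, hb2⟩ := isCompact_Icc.exists_forall_le' hc2 (a := -1) (by
      intro x hx
      have := hpot.v₂_min_unique x (lt_of_lt_of_le hr hx.1) (by linarith [hx.2])
      rwa [hpot.v₂_min] at this)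
    have hc3 : ContinuousOn v₃ (Set.Icc (π + η) (π + π / 8)) :=
      hpot.v₃_smooth.continuousOn.mono fun x hx =>
        ⟨by linarith [hx.1, pi_pos], by linarith [hx.2, pi_pos]⟩
    obtain ⟨a3, ha3, hb3⟩ := isCompact_Icc.exists_forall_le' hc3 (a := 0) (by
      intro x hx
      exact hpot.v₃_min_unique x ⟨by linarith [hx.1, pi_pos], by linarith [hx.2, pi_pos]⟩
        (by linarith [hx.1]))
    set C := v₂ 2 + 1 with hC
    have hC0 : 0 ≤ C := by have := hpot.v₂_lb 2 (by simp); linarith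
    set μ := min m (min (a2 + 1) a3) with hμ
    have hμ0 : 0 < μ := lt_min hm (lt_min (by linarith) ha3)
    refine ⟨μ / (C + 1), by positivity, fun ρ hρ hρ0 b ψ h => ?_⟩
    obtain ⟨hb, hb1, hψ, hψ2, hmin, -⟩ := h
    have hρC : ρ * C < μ := by
      have := (le_div_iff₀ (by positivity)).1 hρ0
      linarith
    have hE := hmin 1 (by simp) 1 (by simp) π ⟨pi_pos.le, by linarith [pi_pos]⟩
    obtain ⟨hL, hc⟩ := sqrt_half hb hψ hψ2
    have h4 : √((1 : ℝ) ^ 2 + 1 ^ 2 - 2 * 1 * 1 * cos π) = 2 := by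
      rw [cos_pi, show (1 : ℝ) ^ 2 + 1 ^ 2 - 2 * 1 * 1 * -1 = 2 ^ 2 by norm_num,
        Real.sqrt_sq (by norm_num)]
    simp only [EcellT, hL, h4, hpot.v₂_min, hpot.v₃_min] at hE
    have hLb := hpot.v₂_lb (2 * b * cos (ψ / 2)) (Set.mem_Ioi.2 (by positivity))
    have hvb := hpot.v₂_lb b hb
    have hv3 := hpot.v₃_nonneg (π + ψ) ⟨by linarith [pi_pos], by linarith [pi_pos]⟩
    have hρL := mul_le_mul_of_nonneg_left hLb hρ.le
    have key : (v₂ b + 1) + v₃ (π + ψ) < μ := by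
      have : ρ * C = ρ * v₂ 2 + ρ := by rw [hC]; ring
      linarith
    constructor
    · by_contra hcon
      push Not at hcon
      rcases lt_or_ge b r with h1 | h1
      · have := hmr b hb h1
        have := min_le_left m (min (a2 + 1) a3)
        linarith
      · have := hb2 b ⟨h1, hcon⟩
        have := (min_le_right m (min (a2 + 1) a3)).trans (min_le_left _ _)
        linarith
    · by_contra hcon
      push Not at hcon
      have := hb3 (π + ψ) ⟨by linarith, by linarith⟩
      have := (min_le_right m (min (a2 + 1) a3)).trans (min_le_right _ _)
      linarith
  · refine ⟨1, one_pos, fun ρ hρ _ b ψ h => ?_⟩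
    exfalso
    push Not at H
    obtain ⟨hb, hb1, hψ, hψ2, hmin, -⟩ := h
    obtain ⟨hL, hc⟩ := sqrt_half hb hψ hψ2
    have hLb := hpot.v₂_lb (2 * b * cos (ψ / 2)) (Set.mem_Ioi.2 (by positivity))
    have hvb := hpot.v₂_lb b hb
    have hv3 := hpot.v₃_min_unique (π + ψ) ⟨by linarith [pi_pos], by linarith [pi_pos]⟩
      (by linarith)
    have hρL := mul_le_mul_of_nonneg_left hLb hρ.le
    set g := v₃ (π + ψ) with hg
    have hcont : ContinuousAt v₂ 1 :=
      (hpot.v₂_smooth.contDiffAt (isOpen_Ioi.mem_nhds (by simp))).continuousAt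
    have hev : ∀ᶠ x in nhds (1 : ℝ), v₂ x ∈ Set.Iio (-1 + g / (4 * ρ)) :=
      hcont.eventually_mem (isOpen_Iio.mem_nhds (by
        rw [hpot.v₂_min, Set.mem_Iio]
        have : 0 < g / (4 * ρ) := by positivity
        linarith))
    obtain ⟨r, hr, hball⟩ := Metric.eventually_nhds_iff.1 hev
    obtain ⟨x, hx0, hxr, hx⟩ := H (g / 4) (by linarith) r hr
    have h1x : v₂ (1 + x) < -1 + g / (4 * ρ) := hball (by
      rw [Real.dist_eq, add_sub_cancel_left, abs_of_pos hx0]; exact hxr)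
    have hE := hmin x hx0 1 (by simp) π ⟨pi_pos.le, by linarith [pi_pos]⟩
    have h4 : √(x ^ 2 + 1 ^ 2 - 2 * x * 1 * cos π) = 1 + x := by
      rw [cos_pi, show x ^ 2 + 1 ^ 2 - 2 * x * 1 * -1 = (1 + x) ^ 2 by ring,
        Real.sqrt_sq (by linarith)]
    simp only [EcellT, hL, h4, hpot.v₂_min, hpot.v₃_min] at hE
    have h5 : ρ * v₂ (1 + x) < -ρ + g / 4 := by
      have := mul_lt_mul_of_pos_left h1x hρ
      have h6 : ρ * (-1 + g / (4 * ρ)) = -ρ + g / 4 := by field_simp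
      linarith
    linarith

set_option maxHeartbeats 1000000 in
/-- Pure algebra behind the lower bound on the Hessian. -/
lemma hess_algebra {A G2 G1 p b s c W κ K c2 ψ X v0 v1 v2 : ℝ} (hψ : 0 < ψ)
    (hA : c2 / 2 ≤ A) (hb : 1 / 2 ≤ b) (hb1 : b ≤ 1) (hs : 0 < s) (hsψ : s ≤ ψ / 2)
    (hc : 0 < c) (hc1 : c ≤ 1) (htan : ψ * c ≤ 2 * s) (hG : G1 = p * (b * s)) (hG0 : 0 ≤ G1)
    (hG1 : G1 ≤ K * ψ ^ 3) (hG2 : κ * ψ ^ 3 ≤ ψ * G2 - G1) (hX : 0 ≤ X)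
    (hW1 : -W ≤ c2 / 32) (hW2 : -W ≤ κ / 2) (hK : 0 < K) (hκ : 0 < κ) (hc2 : 0 < c2)
    (hK1 : K * ψ ^ 2 ≤ c2 / 16) (hK2 : K * ψ ^ 2 ≤ κ / 4) :
    c2 / 4 * (v0 ^ 2 + v1 ^ 2) + κ * ψ ^ 2 / 2 * v2 ^ 2 ≤
      A * (v0 ^ 2 + v1 ^ 2) + G2 * v2 ^ 2 + W * ((v0 + v1) * c - b * s * v2) ^ 2
      + p * (X * (v0 - v1) ^ 2 - s * (v0 + v1) * v2 - b * c / 2 * v2 ^ 2) := by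
  have hbs : 0 < b * s := by positivity
  have hp : 0 ≤ p := by
    by_contra h
    push Not at h
    have := mul_neg_of_neg_of_pos h hbs
    linarith
  have t1 : 0 ≤ p * (X * (v0 - v1) ^ 2) := by positivity
  have hps : p * s ≤ 2 * K * ψ ^ 3 := by
    have h1 : p * s * (1 / 2) ≤ p * s * b := mul_le_mul_of_nonneg_left hb (by positivity)
    nlinarith
  have hps0 : 0 ≤ p * s := by positivity
  have t2 : p * s * ((v0 + v1) * v2) ≤ K * ψ ^ 2 * (2 * (v0 ^ 2 + v1 ^ 2) + ψ ^ 2 * v2 ^ 2) := by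
    have h1 : (v0 + v1) * v2 ≤ |(v0 + v1) * v2| := le_abs_self _
    have h2 : p * s * ((v0 + v1) * v2) ≤ 2 * K * ψ ^ 3 * |(v0 + v1) * v2| :=
      (mul_le_mul_of_nonneg_left h1 hps0).trans (mul_le_mul_of_nonneg_right hps (abs_nonneg _))
    have h3 : 2 * (ψ * |(v0 + v1) * v2|) ≤ 2 * (v0 ^ 2 + v1 ^ 2) + ψ ^ 2 * v2 ^ 2 := by
      rw [abs_mul]
      nlinarith [sq_nonneg (|v0 + v1| - ψ * |v2|), sq_abs (v0 + v1), sq_abs v2,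
        sq_nonneg (v0 - v1)]
    have h4 := mul_le_mul_of_nonneg_left h3 (show 0 ≤ K * ψ ^ 2 by positivity)
    nlinarith
  have t3 : p * (b * c / 2) ≤ G2 - κ * ψ ^ 2 := by
    have h1 : p * b * (ψ * c) ≤ p * b * (2 * s) :=
      mul_le_mul_of_nonneg_left htan (by positivity)
    have h2 : ψ * (p * (b * c / 2)) ≤ ψ * (G2 - κ * ψ ^ 2) := by nlinarith
    exact le_of_mul_le_mul_left h2 hψ
  have t3' := mul_le_mul_of_nonneg_right t3 (sq_nonneg v2)
  have t4 : ((v0 + v1) * c - b * s * v2) ^ 2 ≤ 4 * (v0 ^ 2 + v1 ^ 2) + ψ ^ 2 / 2 * v2 ^ 2 := by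
    have h1 : ((v0 + v1) * c) ^ 2 ≤ (v0 + v1) ^ 2 := by
      rw [mul_pow]
      exact mul_le_of_le_one_right (sq_nonneg _) (pow_le_one₀ hc.le hc1)
    have h2 : (b * s * v2) ^ 2 ≤ ψ ^ 2 / 4 * v2 ^ 2 := by
      rw [mul_pow]
      refine mul_le_mul_of_nonneg_right ?_ (sq_nonneg _)
      have h3 : b * s ≤ ψ / 2 := by nlinarith
      calc (b * s) ^ 2 ≤ (ψ / 2) ^ 2 := pow_le_pow_left₀ hbs.le h3 2
        _ = ψ ^ 2 / 4 := by ring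
    have h4 : ∀ a d : ℝ, (a - d) ^ 2 ≤ 2 * a ^ 2 + 2 * d ^ 2 := fun a d => by
      linarith [sq_nonneg (a + d), add_sq a d, sub_sq a d]
    have h5 := h4 ((v0 + v1) * c) (b * s * v2)
    have h6 : (v0 + v1) ^ 2 ≤ 2 * (v0 ^ 2 + v1 ^ 2) := by
      linarith [sq_nonneg (v0 - v1), add_sq v0 v1, sub_sq v0 v1]
    linarith
  have t5 : -(c2 / 8 * (v0 ^ 2 + v1 ^ 2) + κ / 4 * ψ ^ 2 * v2 ^ 2) ≤
      W * ((v0 + v1) * c - b * s * v2) ^ 2 := by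
    rcases le_or_gt 0 W with h | h
    · have : 0 ≤ W * ((v0 + v1) * c - b * s * v2) ^ 2 := by positivity
      have : 0 ≤ c2 / 8 * (v0 ^ 2 + v1 ^ 2) + κ / 4 * ψ ^ 2 * v2 ^ 2 := by positivity
      linarith
    · have h1 := mul_le_mul_of_nonneg_left t4 (show 0 ≤ -W by linarith)
      have h2 := mul_le_mul_of_nonneg_right hW1 (show 0 ≤ 4 * (v0 ^ 2 + v1 ^ 2) by positivity)
      have h3 := mul_le_mul_of_nonneg_right hW2 (show 0 ≤ ψ ^ 2 / 2 * v2 ^ 2 by positivity)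
      nlinarith
  have t6 := mul_le_mul_of_nonneg_right hA (show 0 ≤ v0 ^ 2 + v1 ^ 2 by positivity)
  have t7 := mul_le_mul_of_nonneg_right hK1 (show 0 ≤ 2 * (v0 ^ 2 + v1 ^ 2) by positivity)
  have t8 := mul_le_mul_of_nonneg_right hK2 (show 0 ≤ ψ ^ 2 * v2 ^ 2 by positivity)
  linarith

lemma smooth_near {v₂ v₃ : ℝ → ℝ} (hpot : PotentialPair v₂ v₃) (ρ : ℝ) (x : Fin 3 → ℝ)
    (h0 : 0 < x 0) (h1 : 0 < x 1) (h2 : π / 2 < x 2) (h3 : x 2 < π + π / 2) :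
    ContDiffAt ℝ (⊤ : ℕ∞) (fun x : Fin 3 → ℝ => EcellT v₂ v₃ ρ (x 0) (x 1) (x 2)) x := by
  have p0 : ∀ i, ContDiffAt ℝ (⊤ : ℕ∞) (fun x : Fin 3 → ℝ => x i) x := fun i =>
    (contDiff_apply ℝ ℝ i).contDiffAt
  have s2 : ∀ y, 0 < y → ContDiffAt ℝ (⊤ : ℕ∞) v₂ y := fun y hy =>
    hpot.v₂_smooth.contDiffAt (isOpen_Ioi.mem_nhds hy)
  have s3 : ContDiffAt ℝ (⊤ : ℕ∞) v₃ (x 2) :=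
    hpot.v₃_smooth.contDiffAt (Icc_mem_nhds (by linarith [pi_pos]) (by linarith [pi_pos]))
  have hcos : cos (x 2) ≤ 0 := cos_nonpos_of_pi_div_two_le_of_le h2.le (by linarith)
  have hq : 0 < x 0 ^ 2 + x 1 ^ 2 - 2 * x 0 * x 1 * cos (x 2) := by
    have : 0 ≤ 2 * x 0 * x 1 * (-cos (x 2)) := mul_nonneg (by positivity) (by linarith)
    nlinarith [pow_pos h0 2, pow_pos h1 2]
  have q : ContDiffAt ℝ (⊤ : ℕ∞)
      (fun x : Fin 3 → ℝ => x 0 ^ 2 + x 1 ^ 2 - 2 * x 0 * x 1 * cos (x 2)) x :=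
    (((p0 0).pow 2).add ((p0 1).pow 2)).sub
      (((contDiffAt_const.mul (p0 0)).mul (p0 1)).mul (p0 2).cos)
  exact ((((s2 _ h0).comp x (p0 0)).add ((s2 _ h1).comp x (p0 1))).add
    (contDiffAt_const.mul ((s2 _ (Real.sqrt_pos.2 hq)).comp x (q.sqrt hq.ne')))).add
    (s3.comp x (p0 2))

lemma two_le_inf : (2 : WithTop ℕ∞) ≤ ((⊤ : ℕ∞) : WithTop ℕ∞) := by
  have h : (2 : ℕ∞) ≤ ⊤ := le_top
  exact WithTop.coe_le_coe.2 h

set_option maxHeartbeats 1000000 in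
/-- smoothness near the minimizers and positivity of the Hessian. -/
theorem cell_energy_hessian (v₂ v₃ : ℝ → ℝ) (hpot : PotentialPair v₂ v₃) :
    ∃ ρ₀ : ℝ, 0 < ρ₀ ∧ ∀ ρ : ℝ, 0 < ρ → ρ ≤ ρ₀ →
      ∀ b0 ψ : ℝ, IsCellMinimizer v₂ v₃ ρ b0 ψ →
        ∃ ε cconv : ℝ, 0 < ε ∧ 0 < cconv ∧
          ∀ s : ℝ, s = 1 ∨ s = -1 →
            ContDiffOn ℝ (⊤ : ℕ∞) (fun x : Fin 3 → ℝ => EcellT v₂ v₃ ρ (x 0) (x 1) (x 2))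
              (Metric.ball (![b0, b0, π + s * ψ]) ε) ∧
            ∀ v : Fin 3 → ℝ,
              cconv * ((v 0) ^ 2 + (v 1) ^ 2 + (v 2) ^ 2) ≤
                (iteratedFDeriv ℝ 2 (fun x : Fin 3 → ℝ => EcellT v₂ v₃ ρ (x 0) (x 1) (x 2))
                  (![b0, b0, π + s * ψ])) ![v, v] := by
  obtain ⟨δ, κ, K, hδ, hκ, hK, hT⟩ := taylor_v3 hpot
  have hc2 := hpot.v₂_conv
  simp only [iteratedDeriv_succ, iteratedDeriv_zero] at hc2
  set c2 := deriv (deriv v₂) 1 with hc2def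
  have sd := deriv_smooth isOpen_Ioi (deriv_smooth isOpen_Ioi hpot.v₂_smooth)
  obtain ⟨M, hM⟩ := isCompact_Icc.exists_bound_of_continuousOn
    (sd.continuousOn.mono (fun x (hx : x ∈ Set.Icc (1 : ℝ) 2) =>
      Set.mem_Ioi.2 (lt_of_lt_of_le one_pos hx.1)))
  have hM0 : 0 ≤ M := (norm_nonneg _).trans (hM 1 ⟨le_rfl, by norm_num⟩)
  have hev : ∀ᶠ x in nhds (1 : ℝ), deriv (deriv v₂) x ∈ Set.Ioi (c2 / 2) :=
    (sd.contDiffAt (isOpen_Ioi.mem_nhds (by simp))).continuousAt.eventually_mem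
      (isOpen_Ioi.mem_nhds (by rw [Set.mem_Ioi]; linarith))
  obtain ⟨r, hr, hball⟩ := Metric.eventually_nhds_iff.1 hev
  obtain ⟨τ, hτ⟩ : ∃ τ, τ = min (c2 / 16) (κ / 4) := ⟨_, rfl⟩
  have hτ0 : 0 < τ := by rw [hτ]; exact lt_min (by linarith) (by linarith)
  obtain ⟨η, hη0, hη1, hηr, hηδ, hηK⟩ : ∃ η : ℝ, 0 < η ∧ η ≤ 1 / 10 ∧ η ≤ r ∧ η ≤ δ ∧
      η ≤ τ / K := by
    refine ⟨min (min (1 / 10) r) (min δ (τ / K)), ?_, ?_, ?_, ?_, ?_⟩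
    · have : 0 < τ / K := by positivity
      exact lt_min (lt_min (by norm_num) hr) (lt_min hδ this)
    · exact (min_le_left _ _).trans (min_le_left _ _)
    · exact (min_le_left _ _).trans (min_le_right _ _)
    · exact (min_le_right _ _).trans (min_le_left _ _)
    · exact (min_le_right _ _).trans (min_le_right _ _)
  obtain ⟨ρ₁, hρ₁, hclose⟩ := minimizer_close hpot η hη0
  refine ⟨min ρ₁ (τ / 2 / (M + 1)), lt_min hρ₁ (by positivity), fun ρ hρ hρ0 b ψ hmin => ?_⟩
  obtain ⟨hbη, hψη⟩ := hclose ρ hρ (hρ0.trans (min_le_left _ _)) b ψ hmin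
  have hcrit := crit_angle hpot ρ b ψ hmin
  obtain ⟨hb, hb1, hψ, hψ2, -, -⟩ := hmin
  have hρM : ρ * M ≤ τ / 2 := by
    have := (le_div_iff₀ (by positivity)).1 (hρ0.trans (min_le_right _ _))
    linarith
  have hτ1 : τ ≤ c2 / 16 := hτ ▸ min_le_left _ _
  have hτ2 : τ ≤ κ / 4 := hτ ▸ min_le_right _ _
  obtain ⟨hL, hc⟩ := sqrt_half hb hψ hψ2
  have hc1 : cos (ψ / 2) ≤ 1 := cos_le_one _
  have hcl : 1 - (ψ / 2) ^ 2 / 2 ≤ cos (ψ / 2) := one_sub_sq_div_two_le_cos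
  have hs : 0 < sin (ψ / 2) := sin_pos_of_pos_of_lt_pi (by linarith) (by linarith [pi_pos])
  have hsψ : sin (ψ / 2) ≤ ψ / 2 := sin_le (by linarith)
  have htan : ψ * cos (ψ / 2) ≤ 2 * sin (ψ / 2) := by
    have := le_tan (x := ψ / 2) (by linarith) (by linarith [pi_pos])
    rw [tan_eq_sin_div_cos, le_div_iff₀ hc] at this
    linarith
  have hA : c2 / 2 ≤ deriv (deriv v₂) b := by
    refine (hball ?_ : _ ∈ Set.Ioi _).le
    rw [Real.dist_eq, abs_lt]
    constructor <;> linarith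
  have hc9 : 0.9 ≤ cos (ψ / 2) := by nlinarith
  have hL2 : 2 * b * cos (ψ / 2) ∈ Set.Icc (1 : ℝ) 2 := by
    constructor <;> nlinarith
  have hW : -(ρ * deriv (deriv v₂) (2 * b * cos (ψ / 2))) ≤ τ / 2 := by
    have h1 := neg_le_of_abs_le (hM _ hL2)
    nlinarith [mul_le_mul_of_nonneg_left h1 hρ.le]
  have hKψ : K * ψ ^ 2 ≤ τ := by
    have h1 := (le_div_iff₀ hK).1 (hψη.le.trans hηK)
    nlinarith [mul_pos hK hψ]
  obtain ⟨g0, g1, g2⟩ := hT ψ hψ (hψη.trans_le hηδ)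
  have key : ∀ v0 v1 v2 : ℝ, c2 / 4 * (v0 ^ 2 + v1 ^ 2) + κ * ψ ^ 2 / 2 * v2 ^ 2 ≤
      deriv (deriv (fun t => EcellT v₂ v₃ ρ (b + t * v0) (b + t * v1) (π + ψ + t * v2))) 0 := by
    intro v0 v1 v2
    rw [curve_second_half hpot ρ b ψ v0 v1 v2 hb hψ hψ2]
    exact hess_algebra hψ hA (by linarith) hb1.le hs hsψ hc hc1 htan hcrit g0 g1 g2
      (by positivity) (by linarith) (by linarith) hK hκ hc2 (by linarith) (by linarith)
  refine ⟨min b (π / 4), min (c2 / 4) (κ * ψ ^ 2 / 2), lt_min hb (by positivity),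
    lt_min (by positivity) (by positivity), fun s hs1 => ?_⟩
  have hsb : -(π / 8) < s * ψ ∧ s * ψ < π / 8 := by
    rcases hs1 with rfl | rfl <;> constructor <;> linarith
  refine ⟨?_, fun v => ?_⟩
  · intro x hx
    have hd : ∀ i, |x i - (![b, b, π + s * ψ] : Fin 3 → ℝ) i| < min b (π / 4) := fun i =>
      lt_of_le_of_lt (by rw [← Real.dist_eq]; exact dist_le_pi_dist x _ i) (Metric.mem_ball.1 hx)
    have m1 := min_le_left b (π / 4)
    have m2 := min_le_right b (π / 4)
    have h0 := (abs_lt.1 (hd 0)).1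
    have h1 := (abs_lt.1 (hd 1)).1
    have h2 := abs_lt.1 (hd 2)
    simp at h0 h1 h2
    exact (smooth_near hpot ρ x (by linarith) (by linarith) (by linarith) (by linarith)).contDiffWithinAt
  · have hsm := smooth_near hpot ρ ![b, b, π + s * ψ] (by simpa using hb) (by simpa using hb)
      (by simp; linarith) (by simp; linarith)
    rw [hess_curve (hsm.of_le two_le_inf)]
    have hfin : min (c2 / 4) (κ * ψ ^ 2 / 2) * (v 0 ^ 2 + v 1 ^ 2 + v 2 ^ 2) ≤
        c2 / 4 * (v 0 ^ 2 + v 1 ^ 2) + κ * ψ ^ 2 / 2 * v 2 ^ 2 := by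
      have a1 := mul_le_mul_of_nonneg_right (min_le_left (c2 / 4) (κ * ψ ^ 2 / 2))
        (show 0 ≤ v 0 ^ 2 + v 1 ^ 2 by positivity)
      have a2 := mul_le_mul_of_nonneg_right (min_le_right (c2 / 4) (κ * ψ ^ 2 / 2))
        (sq_nonneg (v 2))
      linarith
    refine hfin.trans ?_
    rcases hs1 with rfl | rfl
    · have h := key (v 0) (v 1) (v 2)
      simpa using h
    · have h := key (v 0) (v 1) (-v 2)
      have hfun : (fun t : ℝ => EcellT v₂ v₃ ρ (b + t * v 0) (b + t * v 1) (π + ψ + t * -v 2)) =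
          fun t : ℝ => EcellT v₂ v₃ ρ (b + t * v 0) (b + t * v 1) (π + -ψ + t * v 2) := by
        funext t
        have e1 : π + ψ + t * -v 2 = π + (ψ - t * v 2) := by ring
        have e2 : π + -ψ + t * v 2 = π - (ψ - t * v 2) := by ring
        rw [e1, e2]
        simp only [EcellT, hpot.v₃_symm]
        rw [add_comm π, cos_add_pi, cos_pi_sub]
      rw [hfun, neg_sq] at h
      simpa using h

end
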